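/- For every integer g ≥ 3 and every τ ∈ ℍ_g: (2^{2g−2} − 1)·S_{1,8}^g(τ) = 18·S_{2,4}^g(τ) + 168·S_{3,2}^g(τ). -/

import Mathlib

open scoped BigOperators

noncomputable section

/-- The Siegel upper half-space: symmetric complex matrices with positive
definite imaginary part (indexed by a finite type `ι`). -/
def Siegel (ι : Type) [Fintype ι] : Set (Matrix ι ι ℂ) :=
  {τ | τ.IsSymm ∧ ∀ v : ι → ℝ, v ≠ 0 → 0 < ∑ i, ∑ j, v i * (τ i j).im * v j}

/-- The theta function with characteristic `[ε, δ]`. -/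
def theta {ι : Type} [Fintype ι] (ε δ : ι → ZMod 2) (τ : Matrix ι ι ℂ) (z : ι → ℂ) : ℂ :=
  ∑' n : ι → ℤ, Complex.exp ((Real.pi : ℂ) * Complex.I *
    ((∑ i, ∑ j, ((n i : ℂ) + ((ε i).val : ℂ) / 2) * τ i j * ((n j : ℂ) + ((ε j).val : ℂ) / 2)) +
     2 * ∑ i, ((n i : ℂ) + ((ε i).val : ℂ) / 2) * (z i + ((δ i).val : ℂ) / 2)))

/-- A theta characteristic, an element of `𝔽₂^{2g}`. -/
abbrev Char2 (ι : Type) := (ι → ZMod 2) × (ι → ZMod 2)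

/-- Theta function, with the characteristic as a pair. -/
def thetaChar {ι : Type} [Fintype ι] (m : Char2 ι) (τ : Matrix ι ι ℂ) (z : ι → ℂ) : ℂ :=
  theta m.1 m.2 τ z

/-- Theta constant. -/
def thetaConst {ι : Type} [Fintype ι] (m : Char2 ι) (τ : Matrix ι ι ℂ) : ℂ :=
  thetaChar m τ 0

/-- `W` is (the underlying finite set of) an `i`-dimensional affine subspace of `𝔽₂^{2g}`,
i.e. a coset of an `i`-dimensional linear subspace. -/
def IsAffineCosetDim {ι : Type} [Fintype ι] (i : ℕ) (W : Finset (Char2 ι)) : Prop :=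
  ∃ (V : Submodule (ZMod 2) (Char2 ι)) (x : Char2 ι),
    Module.finrank (ZMod 2) V = i ∧ (W : Set (Char2 ι)) = (fun v => x + v) '' (V : Set (Char2 ι))

/-- The modular form `S_{i,s}^g(τ) = Σ_W (Π_{w∈W} θ_w(τ))^s`, the sum over all
`i`-dimensional affine subspaces `W` of `𝔽₂^{2g}`, each counted once. -/
noncomputable def Sform (ι : Type) [Fintype ι] (i s : ℕ) (τ : Matrix ι ι ℂ) : ℂ :=
  letI := Classical.propDecidable
  ∑ W ∈ Finset.univ.filter (fun W : Finset (Char2 ι) => IsAffineCosetDim i W),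
    (∏ w ∈ W, thetaConst w τ) ^ s

section Analytic

/-- The quadratic form `aᵀ τ a` on integer vectors. -/
def latticeForm {ι : Type} [Fintype ι] (τ : Matrix ι ι ℂ) (a : ι → ℤ) : ℂ :=
  ∑ i, ∑ j, (a i : ℂ) * τ i j * (a j : ℂ)

/-- Reduction modulo `2` of an integer vector. -/
def modTwo {ι : Type} (a : ι → ℤ) : ι → ZMod 2 := fun i => (a i : ZMod 2)

/-- The second order theta constant with characteristic `σ`, as a sum over the integer vectors
congruent to `σ` modulo `2`. -/
def secondOrderTheta {ι : Type} [Fintype ι] [DecidableEq ι] (τ : Matrix ι ι ℂ) (σ : ι → ZMod 2) :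
    ℂ :=
  ∑' a : ι → ℤ, if modTwo a = σ then
    Complex.exp (Real.pi * Complex.I * ((1 / 2 : ℝ) : ℂ) * latticeForm τ a) else 0

/-- The nontrivial character of `ZMod 2`. -/
def signChar (x : ZMod 2) : ℂ := (-1) ^ x.val

lemma signChar_zero : signChar 0 = 1 := by simp [signChar]

lemma signChar_add (x y : ZMod 2) : signChar (x + y) = signChar x * signChar y := by
  rw [signChar, signChar, signChar, ← pow_add, ZMod.val_add, ← neg_one_pow_eq_pow_mod_two]

lemma signChar_mul_self (x : ZMod 2) : signChar x * signChar x = 1 := by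
  rw [← signChar_add, CharTwo.add_self_eq_zero, signChar_zero]

lemma summable_prod_apply {ι : Type} [Fintype ι] [DecidableEq ι] {f : ℤ → ℝ}
    (hf : Summable f) (h0 : ∀ n, 0 ≤ f n) : Summable fun a : ι → ℤ => ∏ i, f (a i) := by
  refine summable_of_sum_le (c := ∏ _i : ι, ∑' n, f n)
    (fun a => Finset.prod_nonneg fun i _ => h0 _) fun s => ?_
  calc ∑ a ∈ s, ∏ i, f (a i)
      ≤ ∑ a ∈ Fintype.piFinset fun i => s.image fun a => a i, ∏ i, f (a i) := by
        refine Finset.sum_le_sum_of_subset_of_nonneg (fun a ha => ?_)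
          fun a _ _ => Finset.prod_nonneg fun i _ => h0 _
        rw [Fintype.mem_piFinset]
        exact fun i => Finset.mem_image_of_mem _ ha
    _ = ∏ i, ∑ n ∈ s.image (fun a => a i), f n := (Finset.prod_univ_sum _ _).symm
    _ ≤ _ := Finset.prod_le_prod (fun i _ => Finset.sum_nonneg fun n _ => h0 n)
        fun i _ => hf.sum_le_tsum _ fun n _ => h0 n

lemma summable_exp_neg_mul_abs {r : ℝ} (hr : 0 < r) :
    Summable fun n : ℤ => Real.exp (-r * |(n : ℝ)|) := by
  have h : Summable fun n : ℕ => Real.exp (-r * (n : ℝ)) := by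
    simpa [mul_comm] using Real.summable_exp_nat_mul_iff.2 (neg_lt_zero.2 hr)
  exact Summable.of_nat_of_neg (by simpa using h) (by simpa using h)

lemma exists_pos_le_imForm {ι : Type} [Fintype ι] {τ : Matrix ι ι ℂ} (hτ : τ ∈ Siegel ι) :
    ∃ r : ℝ, 0 < r ∧ ∀ v : ι → ℝ, r * ∑ i, v i ^ 2 ≤ ∑ i, ∑ j, v i * (τ i j).im * v j := by
  let q : EuclideanSpace ℝ ι → ℝ := fun v => ∑ i, ∑ j, v i * (τ i j).im * v j
  have hq : Continuous q := by fun_prop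
  obtain hι | hι := isEmpty_or_nonempty ι
  · exact ⟨1, one_pos, fun v => by simp⟩
  obtain ⟨w, hw, hmin⟩ := (isCompact_sphere (0 : EuclideanSpace ℝ ι) 1).exists_isMinOn
    (NormedSpace.sphere_nonempty.2 zero_le_one) hq.continuousOn
  have hpos : 0 < q w := by
    refine hτ.2 w fun h => ?_
    have : w = 0 := by ext i; exact congrFun h i
    simp [this] at hw
  refine ⟨q w, hpos, fun v => ?_⟩
  by_cases hv : v = 0
  · simp [hv]
  let u : EuclideanSpace ℝ ι := WithLp.toLp 2 v
  have hu : ‖u‖ ≠ 0 := by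
    rw [norm_ne_zero_iff]
    exact fun h => hv (by simpa [u] using h)
  have hsq : ‖u‖ ^ 2 = ∑ i, v i ^ 2 := by simp [EuclideanSpace.norm_sq_eq, u]
  have hle : q w ≤ q (‖u‖⁻¹ • u) := hmin (by simp [norm_smul, hu])
  have hscale : q (‖u‖⁻¹ • u) = (‖u‖ ^ 2)⁻¹ * ∑ i, ∑ j, v i * (τ i j).im * v j := by
    simp only [q, u, PiLp.smul_apply, smul_eq_mul, Finset.mul_sum]
    refine Finset.sum_congr rfl fun i _ => Finset.sum_congr rfl fun j _ => ?_
    ring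
  rw [hscale, le_inv_mul_iff₀ (by positivity)] at hle
  rwa [← hsq, mul_comm]

lemma latticeForm_im {ι : Type} [Fintype ι] (τ : Matrix ι ι ℂ) (a : ι → ℤ) :
    (latticeForm τ a).im = ∑ i, ∑ j, (a i : ℝ) * (τ i j).im * (a j : ℝ) := by
  simp [latticeForm, Complex.im_sum]

lemma summable_norm_exp_latticeForm {ι : Type} [Fintype ι] [DecidableEq ι] {τ : Matrix ι ι ℂ}
    (hτ : τ ∈ Siegel ι) {c : ℝ} (hc : 0 < c) :
    Summable fun a : ι → ℤ => ‖Complex.exp (Real.pi * Complex.I * (c : ℂ) * latticeForm τ a)‖ := by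
  obtain ⟨r, hr, hrq⟩ := exists_pos_le_imForm hτ
  have hs := summable_prod_apply (ι := ι)
    (summable_exp_neg_mul_abs (r := Real.pi * c * r) (by positivity)) fun n => (Real.exp_pos _).le
  refine Summable.of_nonneg_of_le (fun a => norm_nonneg _) (fun a => ?_) hs
  have hre : (Real.pi * Complex.I * (c : ℂ) * latticeForm τ a).re
      = -(Real.pi * c * (latticeForm τ a).im) := by
    simp [Complex.mul_re, Complex.mul_im]
  rw [Complex.norm_exp, ← Real.exp_sum, hre, Real.exp_le_exp, ← Finset.mul_sum, neg_mul,
    neg_le_neg_iff, mul_assoc (Real.pi * c), latticeForm_im]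
  refine mul_le_mul_of_nonneg_left (le_trans ?_ (hrq fun i => a i)) (by positivity)
  refine mul_le_mul_of_nonneg_left (Finset.sum_le_sum fun i _ => ?_) hr.le
  have : |a i| ≤ a i ^ 2 := by
    rw [← sq_abs]
    exact Int.le_self_sq |a i|
  exact_mod_cast this

/-- The term of the theta constant with characteristic `[ε, δ]` at the half-integer point `a / 2`,
where `a` is congruent to `ε` modulo `2`. -/
def thetaTerm {ι : Type} [Fintype ι] (τ : Matrix ι ι ℂ) (δ : ι → ZMod 2) (a : ι → ℤ) : ℂ :=
  Complex.exp (Real.pi * Complex.I * ((1 / 4 : ℝ) : ℂ) * latticeForm τ a) *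
    Complex.exp (((Real.pi / 2 * ∑ i, (a i : ℝ) * (δ i).val : ℝ) : ℂ) * Complex.I)

lemma norm_thetaTerm {ι : Type} [Fintype ι] (τ : Matrix ι ι ℂ) (δ : ι → ZMod 2) (a : ι → ℤ) :
    ‖thetaTerm τ δ a‖ = ‖Complex.exp (Real.pi * Complex.I * ((1 / 4 : ℝ) : ℂ) *
      latticeForm τ a)‖ := by
  rw [thetaTerm, norm_mul, Complex.norm_exp_ofReal_mul_I, mul_one]

lemma thetaConst_eq_tsum {ι : Type} [Fintype ι] [DecidableEq ι] (τ : Matrix ι ι ℂ)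
    (ε δ : ι → ZMod 2) :
    thetaConst (ε, δ) τ = ∑' a : ι → ℤ, if modTwo a = ε then thetaTerm τ δ a else 0 := by
  let e : (ι → ℤ) → (ι → ℤ) := fun n i => 2 * n i + ((ε i).val : ℤ)
  have he : Function.Injective e := fun m n h => by
    ext i
    have := congrFun h i
    simp only [e] at this
    omega
  have hmod (n : ι → ℤ) : modTwo (e n) = ε := by
    ext i
    have h2 : (2 : ZMod 2) = 0 := rfl
    simp [modTwo, e, h2]
  have hsupp : Function.support (fun a : ι → ℤ => if modTwo a = ε then thetaTerm τ δ a else 0)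
      ⊆ Set.range e := by
    intro a ha
    have ha : modTwo a = ε := by
      by_contra h
      simp [h] at ha
    refine ⟨fun i => (a i - (ε i).val) / 2, funext fun i => ?_⟩
    have h0 : ((a i - (ε i).val : ℤ) : ZMod 2) = 0 := by
      simp [← ha, modTwo]
    have hdvd : (2 : ℤ) ∣ a i - (ε i).val := (ZMod.intCast_zmod_eq_zero_iff_dvd _ 2).1 h0
    simp only [e]
    omega
  rw [← he.tsum_eq hsupp]
  refine tsum_congr fun n => ?_
  rw [if_pos (hmod n), thetaTerm, ← Complex.exp_add]
  congr 1
  simp only [latticeForm, e, Pi.zero_apply, zero_add]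
  push_cast
  rw [mul_add]
  simp only [Finset.mul_sum, Finset.sum_mul]
  congr 1
  · exact Finset.sum_congr rfl fun i _ => Finset.sum_congr rfl fun j _ => by ring
  · exact Finset.sum_congr rfl fun i _ => by ring

lemma exp_pi_mul_sum_eq_signChar {ι : Type} [Fintype ι] (s : ι → ℤ) (δ : ι → ZMod 2) :
    Complex.exp (((Real.pi * ∑ i, (s i : ℝ) * (δ i).val : ℝ) : ℂ) * Complex.I)
      = signChar (modTwo s ⬝ᵥ δ) := by
  have hcast : (modTwo s ⬝ᵥ δ) = ((∑ i, s i * (δ i).val : ℤ) : ZMod 2) := by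
    simp [dotProduct, modTwo]
  have hexp : Complex.exp (((Real.pi * ∑ i, (s i : ℝ) * (δ i).val : ℝ) : ℂ) * Complex.I)
      = (-1) ^ (∑ i, s i * (δ i).val : ℤ) := by
    rw [← Complex.exp_pi_mul_I, ← Complex.exp_int_mul]
    push_cast
    ring_nf
  rw [hexp, hcast, signChar]
  generalize (∑ i, s i * (δ i).val : ℤ) = k
  rcases Int.even_or_odd k with hk | hk
  · rw [hk.neg_one_zpow, (ZMod.intCast_zmod_eq_zero_iff_dvd k 2).2 hk.two_dvd]
    simp
  · obtain ⟨l, rfl⟩ := hk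
    have h2 : (2 : ZMod 2) = 0 := rfl
    rw [Odd.neg_one_zpow ⟨l, rfl⟩]
    simp [h2, ZMod.val_one]

lemma latticeForm_add_add_latticeForm_sub {ι : Type} [Fintype ι] (τ : Matrix ι ι ℂ)
    (s d : ι → ℤ) :
    latticeForm τ (s + d) + latticeForm τ (s - d) = 2 * (latticeForm τ s + latticeForm τ d) := by
  simp only [latticeForm, Finset.mul_sum, ← Finset.sum_add_distrib]
  refine Finset.sum_congr rfl fun i _ => Finset.sum_congr rfl fun j _ => ?_
  simp only [Pi.add_apply, Pi.sub_apply]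
  push_cast
  ring

lemma thetaTerm_add_mul_thetaTerm_sub {ι : Type} [Fintype ι] (τ : Matrix ι ι ℂ)
    (δ : ι → ZMod 2) (s d : ι → ℤ) :
    thetaTerm τ δ (s + d) * thetaTerm τ δ (s - d) = signChar (modTwo s ⬝ᵥ δ) *
      (Complex.exp (Real.pi * Complex.I * ((1 / 2 : ℝ) : ℂ) * latticeForm τ s) *
        Complex.exp (Real.pi * Complex.I * ((1 / 2 : ℝ) : ℂ) * latticeForm τ d)) := by
  rw [← exp_pi_mul_sum_eq_signChar, thetaTerm, thetaTerm, mul_mul_mul_comm, mul_comm]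
  simp only [← Complex.exp_add]
  congr 2
  · rw [← add_mul, ← Complex.ofReal_add, ← mul_add, ← Finset.sum_add_distrib]
    congr 2
    simp only [Finset.mul_sum]
    refine Finset.sum_congr rfl fun i _ => ?_
    simp only [Pi.add_apply, Pi.sub_apply]
    push_cast
    ring
  · rw [← mul_add, latticeForm_add_add_latticeForm_sub]
    push_cast
    ring

/-- The addition formula expressing squares of theta constants through second order theta
constants. -/
lemma thetaConst_sq {ι : Type} [Fintype ι] [DecidableEq ι] {τ : Matrix ι ι ℂ}
    (hτ : τ ∈ Siegel ι) (ε δ : ι → ZMod 2) :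
    thetaConst (ε, δ) τ ^ 2 =
      ∑ σ, signChar (σ ⬝ᵥ δ) * (secondOrderTheta τ σ * secondOrderTheta τ (σ + ε)) := by
  let E (a : ι → ℤ) : ℂ :=
    Complex.exp (Real.pi * Complex.I * ((1 / 2 : ℝ) : ℂ) * latticeForm τ a)
  have hE (σ : ι → ZMod 2) : Summable fun a => ‖if modTwo a = σ then E a else 0‖ :=
    (summable_norm_exp_latticeForm hτ (c := 1 / 2) (by norm_num)).of_nonneg_of_le
      (fun a => norm_nonneg _) fun a => by split_ifs <;> simp [E]
  have hθ : Summable fun a => ‖if modTwo a = ε then thetaTerm τ δ a else 0‖ :=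
    (summable_norm_exp_latticeForm hτ (c := 1 / 4) (by norm_num)).of_nonneg_of_le
      (fun a => norm_nonneg _) fun a => by
        rw [← norm_thetaTerm τ δ]
        split_ifs <;> simp
  let e : (ι → ℤ) × (ι → ℤ) → (ι → ℤ) × (ι → ℤ) := fun p => (p.1 + p.2, p.1 - p.2)
  have he : Function.Injective e := fun p q h => by
    simp only [e, Prod.mk.injEq] at h
    refine Prod.ext (funext fun i => ?_) (funext fun i => ?_) <;>
    · have h1 := congrFun h.1 i
      have h2 := congrFun h.2 i
      simp only [Pi.add_apply, Pi.sub_apply] at h1 h2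
      omega
  have hsupp : Function.support (fun p : (ι → ℤ) × (ι → ℤ) =>
      (if modTwo p.1 = ε then thetaTerm τ δ p.1 else 0) *
        (if modTwo p.2 = ε then thetaTerm τ δ p.2 else 0)) ⊆ Set.range e := by
    rintro ⟨a, b⟩ hab
    have ha : modTwo a = ε := by
      by_contra h
      simp [h] at hab
    have hb : modTwo b = ε := by
      by_contra h
      simp [h] at hab
    have hdvd (i : ι) : (2 : ℤ) ∣ a i - b i := by
      refine (ZMod.intCast_zmod_eq_zero_iff_dvd _ 2).1 ?_
      have := congrFun (ha.trans hb.symm) i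
      simp only [modTwo] at this
      simp [this]
    refine ⟨(fun i => b i + (a i - b i) / 2, fun i => (a i - b i) / 2), ?_⟩
    refine Prod.ext (funext fun i => ?_) (funext fun i => ?_) <;>
    · have := hdvd i
      simp only [e, Pi.add_apply, Pi.sub_apply]
      omega
  rw [thetaConst_eq_tsum, sq, tsum_mul_tsum_of_summable_norm hθ hθ, ← he.tsum_eq hsupp]
  have hterm (p : (ι → ℤ) × (ι → ℤ)) :
      (if modTwo (e p).1 = ε then thetaTerm τ δ (e p).1 else 0) *
        (if modTwo (e p).2 = ε then thetaTerm τ δ (e p).2 else 0) =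
      ∑ σ, signChar (σ ⬝ᵥ δ) * ((if modTwo p.1 = σ then E p.1 else 0) *
        (if modTwo p.2 = σ + ε then E p.2 else 0)) := by
    rw [Finset.sum_eq_single (modTwo p.1) (fun σ _ hσ => by simp [hσ.symm]) (by simp), if_pos rfl]
    have h1 : modTwo (e p).1 = ε ↔ modTwo p.2 = modTwo p.1 + ε := by
      have : modTwo (e p).1 = modTwo p.1 + modTwo p.2 := by ext i; simp [modTwo, e]
      rw [this]
      constructor
      · rintro rfl
        rw [← add_assoc, ZModModule.add_self, zero_add]
      · intro h
        rw [h, ← add_assoc, ZModModule.add_self, zero_add]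
    have h2 : modTwo (e p).2 = modTwo (e p).1 := by
      ext i
      simp [modTwo, e, CharTwo.sub_eq_add]
    rw [h2]
    by_cases h : modTwo (e p).1 = ε
    · rw [if_pos h, if_pos h, if_pos (h1.1 h)]
      exact thetaTerm_add_mul_thetaTerm_sub τ δ p.1 p.2
    · rw [if_neg h, if_neg (mt h1.2 h)]
      simp
  rw [tsum_congr hterm, Summable.tsum_finsetSum fun σ _ =>
    ((summable_mul_of_summable_norm (hE σ) (hE (σ + ε))).mul_left _)]
  refine Finset.sum_congr rfl fun σ _ => ?_
  rw [tsum_mul_left, ← tsum_mul_tsum_of_summable_norm (hE σ) (hE (σ + ε))]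
  rfl

end Analytic

section Fourier

lemma sum_signChar_dotProduct {ι : Type} [Fintype ι] [DecidableEq ι] (x : ι → ZMod 2) :
    ∑ y, signChar (x ⬝ᵥ y) = if x = 0 then 2 ^ Fintype.card ι else 0 := by
  split_ifs with hx
  · simp [hx, signChar_zero, ZMod.card]
  · obtain ⟨i, hi⟩ := Function.ne_iff.1 hx
    have hi : x i = 1 := Fin.eq_one_of_ne_zero (x i) hi
    have h1 : signChar 1 = -1 := by simp [signChar, ZMod.val_one]
    have h : ∑ y, signChar (x ⬝ᵥ y) = -∑ y, signChar (x ⬝ᵥ y) := by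
      conv_lhs => rw [← Equiv.sum_comp (Equiv.addRight (Pi.single i 1))]
      simp [dotProduct_add, hi, signChar_add, h1]
    linear_combination h / 2

/-- The symplectic pairing on `𝔽₂^{2g}`. -/
def charPairing {ι : Type} [Fintype ι] (m n : Char2 ι) : ZMod 2 :=
  m.2 ⬝ᵥ n.1 + m.1 ⬝ᵥ n.2

lemma charPairing_add_left {ι : Type} [Fintype ι] (m k n : Char2 ι) :
    charPairing (m + k) n = charPairing m n + charPairing k n := by
  simp only [charPairing, Prod.fst_add, Prod.snd_add, add_dotProduct]
  ring

lemma sum_signChar_charPairing {ι : Type} [Fintype ι] [DecidableEq ι] (m : Char2 ι) :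
    ∑ n, signChar (charPairing m n) = if m = 0 then (2 ^ Fintype.card ι) ^ 2 else 0 := by
  simp only [charPairing, signChar_add, Fintype.sum_prod_type, ← Finset.mul_sum, ← Finset.sum_mul,
    sum_signChar_dotProduct]
  obtain ⟨a, b⟩ := m
  by_cases ha : a = 0 <;> by_cases hb : b = 0 <;> simp [ha, hb, sq]

/-- The square of a theta constant, as a quadratic form in the second order theta constants. -/
def quadTheta {ι : Type} [Fintype ι] [DecidableEq ι] (X : (ι → ZMod 2) → ℂ) (m : Char2 ι) : ℂ :=
  ∑ σ, signChar (σ ⬝ᵥ m.2) * (X σ * X (σ + m.1))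

/-- Riemann's quartic relation. -/
lemma fourier_quadTheta_mul {ι : Type} [Fintype ι] [DecidableEq ι] (X : (ι → ZMod 2) → ℂ)
    (h n : Char2 ι) :
    ∑ m, signChar (charPairing m n) * (quadTheta X m * quadTheta X (m + h)) =
      2 ^ Fintype.card ι * signChar (n.1 ⬝ᵥ h.2) *
        (quadTheta X (n + (0, h.2)) * quadTheta X (n + (0, h.2) + h)) := by
  obtain ⟨a, b⟩ := n
  obtain ⟨α, β⟩ := h
  have hβ : b + β + β = b := by rw [add_assoc, ZModModule.add_self, add_zero]
  simp only [quadTheta, charPairing, Prod.mk_add_mk, Fintype.sum_prod_type, Prod.fst_add,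
    Prod.snd_add, add_zero, hβ]
  calc ∑ ε, ∑ δ, signChar (δ ⬝ᵥ a + ε ⬝ᵥ b) *
        ((∑ σ, signChar (σ ⬝ᵥ δ) * (X σ * X (σ + ε))) *
          ∑ ρ, signChar (ρ ⬝ᵥ (δ + β)) * (X ρ * X (ρ + (ε + α))))
      = ∑ ε, ∑ σ, ∑ ρ, signChar (ε ⬝ᵥ b) * signChar (ρ ⬝ᵥ β) *
          (X σ * X (σ + ε) * X ρ * X (ρ + (ε + α))) * ∑ δ, signChar ((a + σ + ρ) ⬝ᵥ δ) := by
        refine Finset.sum_congr rfl fun ε _ => ?_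
        simp only [Finset.sum_mul_sum]
        simp only [Finset.mul_sum]
        rw [Finset.sum_comm]
        refine Finset.sum_congr rfl fun σ _ => ?_
        rw [Finset.sum_comm]
        refine Finset.sum_congr rfl fun ρ _ => Finset.sum_congr rfl fun δ _ => ?_
        simp only [dotProduct_add, add_dotProduct, signChar_add, dotProduct_comm δ a]
        ring
    _ = ∑ ε, ∑ σ, signChar (ε ⬝ᵥ b) * signChar ((a + σ) ⬝ᵥ β) *
          (X σ * X (σ + ε) * X (a + σ) * X (a + σ + (ε + α))) * 2 ^ Fintype.card ι := by
        refine Finset.sum_congr rfl fun ε _ => Finset.sum_congr rfl fun σ _ => ?_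
        have hzero (ρ : ι → ZMod 2) : a + σ + ρ = 0 ↔ ρ = a + σ := by
          rw [add_eq_zero_iff_eq_neg, ZModModule.neg_eq_self, eq_comm]
        simp only [sum_signChar_dotProduct, hzero, mul_ite, mul_zero, Finset.sum_ite_eq',
          Finset.mem_univ, if_true]
    _ = ∑ σ, ∑ μ, signChar ((σ + μ) ⬝ᵥ b) * signChar ((a + σ) ⬝ᵥ β) *
          (X σ * X μ * X (σ + a) * X (μ + (a + α))) * 2 ^ Fintype.card ι := by
        rw [Finset.sum_comm]
        refine Finset.sum_congr rfl fun σ _ => ?_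
        rw [← Equiv.sum_comp (Equiv.addLeft σ)]
        refine Finset.sum_congr rfl fun μ _ => ?_
        have h1 : σ + (σ + μ) = μ := by rw [← add_assoc, ZModModule.add_self, zero_add]
        have h2 : a + σ + (σ + μ + α) = μ + (a + α) := by
          rw [show a + σ + (σ + μ + α) = σ + (σ + μ) + (a + α) by abel, h1]
        simp only [Equiv.coe_addLeft, h1, h2, add_comm σ a]
    _ = _ := by
        rw [Finset.sum_mul_sum, Finset.mul_sum]
        refine Finset.sum_congr rfl fun σ _ => ?_
        rw [Finset.mul_sum]
        refine Finset.sum_congr rfl fun μ _ => ?_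
        simp only [dotProduct_add, add_dotProduct, signChar_add]
        ring

lemma sum_fourier_pow_four {ι : Type} [Fintype ι] [DecidableEq ι] (f : Char2 ι → ℂ) :
    ∑ n, (∑ m, signChar (charPairing m n) * f m) ^ 4 =
      (2 ^ Fintype.card ι) ^ 2 *
        ∑ k, ∑ l, ∑ m, f m * f (m + k) * f (m + l) * f (m + k + l) := by
  calc ∑ n, (∑ m, signChar (charPairing m n) * f m) ^ 4
      = ∑ p, ∑ q, ∑ r, ∑ s, f p * f q * f r * f s *
          ∑ n, signChar (charPairing (p + q + r + s) n) := by
        simp only [Finset.mul_sum]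
        have hn (n : Char2 ι) : (∑ m, signChar (charPairing m n) * f m) ^ 4 =
            ∑ p, ∑ q, ∑ r, ∑ s, f p * f q * f r * f s *
              signChar (charPairing (p + q + r + s) n) := by
          rw [pow_succ, pow_three']
          simp only [Finset.sum_mul, Finset.mul_sum]
          refine Finset.sum_congr rfl fun p _ => Finset.sum_congr rfl fun q _ =>
            Finset.sum_congr rfl fun r _ => Finset.sum_congr rfl fun s _ => ?_
          simp only [charPairing_add_left, signChar_add]
          ring
        simp only [hn]
        rw [Finset.sum_comm]
        refine Finset.sum_congr rfl fun p _ => ?_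
        rw [Finset.sum_comm]
        refine Finset.sum_congr rfl fun q _ => ?_
        rw [Finset.sum_comm]
        refine Finset.sum_congr rfl fun r _ => ?_
        rw [Finset.sum_comm]
    _ = ∑ p, ∑ q, ∑ r, f p * f q * f r * f (p + q + r) * (2 ^ Fintype.card ι) ^ 2 := by
        refine Finset.sum_congr rfl fun p _ => Finset.sum_congr rfl fun q _ =>
          Finset.sum_congr rfl fun r _ => ?_
        have hzero (s : Char2 ι) : p + q + r + s = 0 ↔ s = p + q + r := by
          rw [add_eq_zero_iff_eq_neg, ZModModule.neg_eq_self, eq_comm]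
        simp only [sum_signChar_charPairing, hzero, mul_ite, mul_zero, Finset.sum_ite_eq',
          Finset.mem_univ, if_true]
    _ = ∑ m, ∑ k, ∑ l, f m * f (m + k) * f (m + l) * f (m + k + l) *
          (2 ^ Fintype.card ι) ^ 2 := by
        refine Finset.sum_congr rfl fun m _ => ?_
        rw [← Equiv.sum_comp (Equiv.addLeft m)]
        refine Finset.sum_congr rfl fun k _ => ?_
        rw [← Equiv.sum_comp (Equiv.addLeft m)]
        refine Finset.sum_congr rfl fun l _ => ?_
        have hm : m + (m + k) + (m + l) = m + k + l := by
          rw [← add_assoc m m k, ZModModule.add_self]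
          abel
        simp only [Equiv.coe_addLeft, hm]
    _ = _ := by
        simp only [← Finset.sum_mul]
        rw [mul_comm, Finset.sum_comm]
        congr 1
        exact Finset.sum_congr rfl fun k _ => Finset.sum_comm

lemma sum_parallelepiped_eq {ι : Type} [Fintype ι] [DecidableEq ι] (X : (ι → ZMod 2) → ℂ)
    (h : Char2 ι) {f : Char2 ι → ℂ} (hf : ∀ m, f m = quadTheta X m * quadTheta X (m + h)) :
    ∑ k, ∑ l, ∑ m, f m * f (m + k) * f (m + l) * f (m + k + l) =
      (2 ^ Fintype.card ι) ^ 2 * ∑ m, f m ^ 4 := by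
  have hne : ((2 : ℂ) ^ Fintype.card ι) ^ 2 ≠ 0 := pow_ne_zero _ (pow_ne_zero _ two_ne_zero)
  refine mul_left_cancel₀ hne ?_
  rw [← sum_fourier_pow_four, ← Equiv.sum_comp (Equiv.addRight ((0, h.2) : Char2 ι)) (f · ^ 4),
    Finset.mul_sum, Finset.mul_sum]
  refine Finset.sum_congr rfl fun n _ => ?_
  have hsign : signChar (n.1 ⬝ᵥ h.2) ^ 4 = 1 := by
    linear_combination (signChar (n.1 ⬝ᵥ h.2) ^ 2 + 1) * signChar_mul_self (n.1 ⬝ᵥ h.2)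
  simp only [hf, fourier_quadTheta_mul, Equiv.coe_addRight]
  rw [mul_pow, mul_pow, hsign]
  ring

end Fourier

section Counting

lemma sum_compl_zero_pair_add {V : Type} [AddCommGroup V] [Fintype V] [DecidableEq V] {h : V}
    (hh : h ≠ 0) (φ : V → ℂ) : ∑ k, φ k = ∑ k ∈ {0, h}ᶜ, φ k + (φ 0 + φ h) := by
  rw [← Finset.sum_pair hh.symm, Finset.sum_compl_add_sum]

/-- Splitting off the degenerate parallelepipeds. -/
lemma sum_parallelepiped_eq_add {V : Type} [AddCommGroup V] [Module (ZMod 2) V] [Fintype V]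
    [DecidableEq V] {h : V} (hh : h ≠ 0) {f : V → ℂ} (hf : ∀ m, f (m + h) = f m) :
    ∑ k, ∑ l, ∑ m, f m * f (m + k) * f (m + l) * f (m + k + l) =
      ∑ k ∈ {0, h}ᶜ, ∑ l ∈ {0, h, k, k + h}ᶜ, ∑ m, f m * f (m + k) * f (m + l) * f (m + k + l) +
        6 * ∑ k ∈ {0, h}ᶜ, ∑ m, f m ^ 2 * f (m + k) ^ 2 + 4 * ∑ m, f m ^ 4 := by
  let Φ (k l : V) : ℂ := ∑ m, f m * f (m + k) * f (m + l) * f (m + k + l)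
  let Ψ (k : V) : ℂ := ∑ m, f m ^ 2 * f (m + k) ^ 2
  have hfk (m k : V) : f (m + (k + h)) = f (m + k) := by rw [← add_assoc, hf]
  have hΦ0 (k : V) : Φ k 0 = Ψ k := Finset.sum_congr rfl fun m _ => by
    simp only [add_zero]; ring
  have hΦh (k : V) : Φ k h = Ψ k := Finset.sum_congr rfl fun m _ => by
    simp only [hf]; ring
  have hcancel (m k : V) : m + k + k = m := by rw [add_assoc, ZModModule.add_self, add_zero]
  have hΦk (k : V) : Φ k k = Ψ k := Finset.sum_congr rfl fun m _ => by
    simp only [hcancel]; ring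
  have hΦkh (k : V) : Φ k (k + h) = Ψ k := Finset.sum_congr rfl fun m _ => by
    simp only [hfk, hcancel]; ring
  have hΦzero_left (l : V) : Φ 0 l = Ψ l := Finset.sum_congr rfl fun m _ => by
    simp only [add_zero]; ring
  have hΦh_left (l : V) : Φ h l = Ψ l := Finset.sum_congr rfl fun m _ => by
    simp only [hf, add_right_comm m h l]; ring
  have hinner {k : V} (hk : k ∈ ({0, h}ᶜ : Finset V)) :
      ∑ l, Φ k l = ∑ l ∈ {0, h, k, k + h}ᶜ, Φ k l + 4 * Ψ k := by
    simp only [Finset.mem_compl, Finset.mem_insert, Finset.mem_singleton, not_or] at hk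
    have hkh : k + h ≠ 0 := fun e => hk.2 (by
      rw [← hcancel k h, e, zero_add])
    rw [← Finset.sum_compl_add_sum ({0, h, k, k + h} : Finset V),
      Finset.sum_insert (by simp [hh.symm, Ne.symm hk.1, hkh.symm]),
      Finset.sum_insert (by simp [Ne.symm hk.2, hk.1]),
      Finset.sum_pair (by simpa using hh), hΦ0, hΦh, hΦk, hΦkh]
    ring
  have hΨ0 : Ψ 0 = ∑ m, f m ^ 4 := Finset.sum_congr rfl fun m _ => by
    simp only [add_zero]; ring
  have hΨh : Ψ h = ∑ m, f m ^ 4 := Finset.sum_congr rfl fun m _ => by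
    simp only [hf]; ring
  change ∑ k, ∑ l, Φ k l = ∑ k ∈ {0, h}ᶜ, ∑ l ∈ {0, h, k, k + h}ᶜ, Φ k l +
    6 * ∑ k ∈ {0, h}ᶜ, Ψ k + 4 * ∑ m, f m ^ 4
  rw [sum_compl_zero_pair_add hh, Finset.sum_congr rfl fun k hk => hinner hk,
    Finset.sum_add_distrib, ← Finset.mul_sum]
  simp only [hΦzero_left, hΦh_left]
  rw [sum_compl_zero_pair_add hh Ψ, hΨ0, hΨh]
  ring

end Counting

section AffineSubspaces

/-- The points of the affine subspace through `m` with directions `v`. -/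
def cosetPoints {ι : Type} [Fintype ι] [DecidableEq ι] {i : ℕ} (m : Char2 ι)
    (v : Fin i → Char2 ι) : Finset (Char2 ι) :=
  Finset.univ.image fun c : Fin i → ZMod 2 => m + ∑ j, c j • v j

lemma mem_cosetPoints {ι : Type} [Fintype ι] [DecidableEq ι] {i : ℕ} {m w : Char2 ι}
    {v : Fin i → Char2 ι} :
    w ∈ cosetPoints m v ↔ ∃ u ∈ Submodule.span (ZMod 2) (Set.range v), m + u = w := by
  simp only [cosetPoints, Finset.mem_image, Finset.mem_univ, true_and,
    Submodule.mem_span_range_iff_exists_fun]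
  constructor
  · rintro ⟨c, rfl⟩
    exact ⟨_, ⟨c, rfl⟩, rfl⟩
  · rintro ⟨_, ⟨c, rfl⟩, rfl⟩
    exact ⟨c, rfl⟩

lemma prod_cosetPoints {ι : Type} [Fintype ι] [DecidableEq ι] {i : ℕ} {m : Char2 ι}
    {v : Fin i → Char2 ι} (hv : LinearIndependent (ZMod 2) v) (φ : Char2 ι → ℂ) :
    ∏ w ∈ cosetPoints m v, φ w = ∏ c : Fin i → ZMod 2, φ (m + ∑ j, c j • v j) := by
  refine Finset.prod_image fun c _ d _ hcd => ?_
  have h : ∑ j, (c j - d j) • v j = 0 := by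
    simp only [sub_smul, Finset.sum_sub_distrib]
    exact sub_eq_zero.2 (add_left_cancel hcd)
  exact funext fun j => sub_eq_zero.1 (Fintype.linearIndependent_iff.1 hv _ h j)

lemma isAffineCosetDim_cosetPoints {ι : Type} [Fintype ι] [DecidableEq ι] {i : ℕ} (m : Char2 ι)
    {v : Fin i → Char2 ι} (hv : LinearIndependent (ZMod 2) v) :
    IsAffineCosetDim i (cosetPoints m v) := by
  refine ⟨Submodule.span (ZMod 2) (Set.range v), m, ?_, ?_⟩
  · rw [finrank_span_eq_card hv, Fintype.card_fin]
  · ext w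
    rw [Finset.mem_coe, mem_cosetPoints]
    rfl

open Classical in
lemma card_frames {ι : Type} [Fintype ι] [DecidableEq ι] {i : ℕ} {W : Finset (Char2 ι)}
    (hW : IsAffineCosetDim i W) :
    (Finset.univ.filter fun p : Char2 ι × (Fin i → Char2 ι) =>
      LinearIndependent (ZMod 2) p.2 ∧ cosetPoints p.1 p.2 = W).card =
      2 ^ i * ∏ j : Fin i, (2 ^ i - 2 ^ j.val) := by
  obtain ⟨V, x, hV, hWV⟩ := hW
  have hmem (w : Char2 ι) : w ∈ W ↔ ∃ u ∈ V, x + u = w := by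
    rw [← Finset.mem_coe, hWV]
    rfl
  let e : V × {s : Fin i → V // LinearIndependent (ZMod 2) s} → Char2 ι × (Fin i → Char2 ι) :=
    fun p => (x + p.1, fun j => p.2.1 j)
  have he : Function.Injective e := by
    rintro ⟨u, s⟩ ⟨y, t⟩ h
    simp only [e, Prod.mk.injEq, add_right_inj, SetLike.coe_eq_coe] at h
    refine Prod.ext h.1 (Subtype.ext (funext fun j => Subtype.ext (congrFun h.2 j)))
  have himage : (Finset.univ.filter fun p : Char2 ι × (Fin i → Char2 ι) =>
      LinearIndependent (ZMod 2) p.2 ∧ cosetPoints p.1 p.2 = W) = Finset.univ.image e := by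
    ext ⟨m, v⟩
    simp only [Finset.mem_filter, Finset.mem_univ, true_and, Finset.mem_image]
    constructor
    · rintro ⟨hv, hmv⟩
      have hpt (u : Char2 ι) (hu : u ∈ Submodule.span (ZMod 2) (Set.range v)) :
          ∃ y ∈ V, x + y = m + u := by
        rw [← hmem, ← hmv]
        exact mem_cosetPoints.2 ⟨u, hu, rfl⟩
      obtain ⟨u, hu, hxu⟩ := hpt 0 (zero_mem _)
      rw [add_zero] at hxu
      have hvV (j : Fin i) : v j ∈ V := by
        obtain ⟨y, hy, hxy⟩ := hpt (v j) (Submodule.subset_span ⟨j, rfl⟩)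
        rw [← hxu, add_assoc, add_right_inj] at hxy
        rw [show v j = y - u by rw [hxy]; abel]
        exact sub_mem hy hu
      exact ⟨(⟨u, hu⟩, ⟨fun j => ⟨v j, hvV j⟩, LinearIndependent.of_comp V.subtype hv⟩),
        Prod.ext hxu rfl⟩
    · rintro ⟨⟨u, s, hs⟩, h⟩
      obtain ⟨rfl, rfl⟩ := Prod.mk.inj h
      have hspan : Submodule.span (ZMod 2) (Set.range fun j => (s j : Char2 ι)) = V := by
        have htop := hs.span_eq_top_of_card_eq_finrank' (by rw [hV, Fintype.card_fin])
        have := congrArg (Submodule.map V.subtype) htop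
        rwa [Submodule.map_span, ← Set.range_comp, Submodule.map_subtype_top] at this
      refine ⟨hs.map' V.subtype V.ker_subtype, ?_⟩
      ext w
      rw [mem_cosetPoints, hspan, hmem]
      constructor
      · rintro ⟨y, hy, rfl⟩
        exact ⟨u + y, add_mem u.2 hy, (add_assoc _ _ _).symm⟩
      · rintro ⟨y, hy, rfl⟩
        exact ⟨y - u, sub_mem hy u.2, by dsimp only; abel⟩
  rw [himage, Finset.card_image_of_injective _ he, Finset.card_univ, Fintype.card_prod,
    Module.card_eq_pow_finrank (K := ZMod 2) (V := V), hV, ZMod.card, ← Nat.card_eq_fintype_card,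
    card_linearIndependent hV.ge, hV, ZMod.card]

open Classical in
lemma Sform_mul_card_frames {ι : Type} [Fintype ι] [DecidableEq ι] (i s : ℕ)
    (τ : Matrix ι ι ℂ) :
    ((2 ^ i * ∏ j : Fin i, (2 ^ i - 2 ^ j.val) : ℕ) : ℂ) * Sform ι i s τ =
      ∑ v : Fin i → Char2 ι with LinearIndependent (ZMod 2) v,
        ∑ m, (∏ c : Fin i → ZMod 2, thetaConst (m + ∑ j, c j • v j) τ) ^ s := by
  have hS : Sform ι i s τ = ∑ W : Finset (Char2 ι) with IsAffineCosetDim i W,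
      (∏ w ∈ W, thetaConst w τ) ^ s := by
    unfold Sform
    congr!
  have hmaps : ∀ p ∈ Finset.univ.filter (fun p : Char2 ι × (Fin i → Char2 ι) =>
      LinearIndependent (ZMod 2) p.2), cosetPoints p.1 p.2 ∈
        Finset.univ.filter fun W : Finset (Char2 ι) => IsAffineCosetDim i W := by
    intro p hp
    simp only [Finset.mem_filter, Finset.mem_univ, true_and] at hp ⊢
    exact isAffineCosetDim_cosetPoints p.1 hp
  calc _ = ∑ p : Char2 ι × (Fin i → Char2 ι) with LinearIndependent (ZMod 2) p.2,
        (∏ w ∈ cosetPoints p.1 p.2, thetaConst w τ) ^ s := by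
        rw [← Finset.sum_fiberwise_of_maps_to hmaps, hS, Finset.mul_sum]
        refine Finset.sum_congr rfl fun W hW => ?_
        rw [Finset.filter_filter, ← card_frames (Finset.mem_filter.1 hW).2, ← nsmul_eq_mul,
          ← Finset.sum_const]
        refine Finset.sum_congr rfl fun p hp => ?_
        rw [(Finset.mem_filter.1 hp).2.2]
    _ = ∑ p : Char2 ι × (Fin i → Char2 ι) with LinearIndependent (ZMod 2) p.2,
        (∏ c : Fin i → ZMod 2, thetaConst (p.1 + ∑ j, c j • p.2 j) τ) ^ s := by
        refine Finset.sum_congr rfl fun p hp => ?_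
        rw [prod_cosetPoints (Finset.mem_filter.1 hp).2]
    _ = _ := by
        simp only [Finset.sum_filter]
        rw [Fintype.sum_prod_type, Finset.sum_comm]
        refine Finset.sum_congr rfl fun v _ => ?_
        split_ifs <;> simp

open Classical in
lemma sum_linearIndependent_succ {ι : Type} [Fintype ι] [DecidableEq ι] {n : ℕ}
    (φ : (Fin (n + 1) → Char2 ι) → ℂ) :
    ∑ v with LinearIndependent (ZMod 2) v, φ v =
      ∑ w : Fin n → Char2 ι with LinearIndependent (ZMod 2) w,
        ∑ x with x ∉ Submodule.span (ZMod 2) (Set.range w), φ (Fin.cons x w) := by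
  simp only [Finset.sum_filter]
  rw [← Equiv.sum_comp (Fin.consEquiv fun _ => Char2 ι), Fintype.sum_prod_type, Finset.sum_comm]
  refine Finset.sum_congr rfl fun w _ => ?_
  have hcons (x : Char2 ι) : Fin.consEquiv (fun _ => Char2 ι) (x, w) = Fin.cons x w := rfl
  simp only [hcons, linearIndependent_finCons]
  split_ifs with hw <;> simp [hw]

lemma exists_zmod_two_iff {p : ZMod 2 → Prop} : (∃ a, p a) ↔ p 0 ∨ p 1 := Fin.exists_fin_two

open Classical in
lemma sum_linearIndependent_one {ι : Type} [Fintype ι] [DecidableEq ι]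
    (φ : (Fin 1 → Char2 ι) → ℂ) :
    ∑ v with LinearIndependent (ZMod 2) v, φ v = ∑ h ∈ {0}ᶜ, φ ![h] := by
  rw [sum_linearIndependent_succ, Finset.sum_filter, Fintype.sum_unique,
    if_pos (linearIndependent_empty_type)]
  refine Finset.sum_congr ?_ fun h _ => by congr! 1
  ext h
  simp

open Classical in
lemma sum_linearIndependent_two {ι : Type} [Fintype ι] [DecidableEq ι]
    (φ : (Fin 2 → Char2 ι) → ℂ) :
    ∑ v with LinearIndependent (ZMod 2) v, φ v = ∑ h ∈ {0}ᶜ, ∑ k ∈ {0, h}ᶜ, φ ![k, h] := by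
  rw [sum_linearIndependent_succ, sum_linearIndependent_one]
  refine Finset.sum_congr rfl fun h _ => Finset.sum_congr ?_ fun k _ => rfl
  ext k
  simp [Submodule.mem_span_singleton, exists_zmod_two_iff, eq_comm]

open Classical in
lemma sum_linearIndependent_three {ι : Type} [Fintype ι] [DecidableEq ι]
    (φ : (Fin 3 → Char2 ι) → ℂ) :
    ∑ v with LinearIndependent (ZMod 2) v, φ v =
      ∑ h ∈ {0}ᶜ, ∑ k ∈ {0, h}ᶜ, ∑ l ∈ {0, h, k, k + h}ᶜ, φ ![l, k, h] := by
  rw [sum_linearIndependent_succ, sum_linearIndependent_two]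
  refine Finset.sum_congr rfl fun h _ => Finset.sum_congr rfl fun k _ =>
    Finset.sum_congr ?_ fun l _ => rfl
  ext l
  simp only [Matrix.range_cons, Matrix.range_empty, Set.union_empty, Set.singleton_union,
    Submodule.mem_span_pair, exists_zmod_two_iff, zero_smul, one_smul, zero_add, add_zero,
    Finset.mem_filter, Finset.mem_univ, true_and, Finset.mem_compl, Finset.mem_insert,
    Finset.mem_singleton]
  grind

lemma prod_affine_vecCons {ι : Type} {n : ℕ} (φ : Char2 ι → ℂ) (m x : Char2 ι)
    (v : Fin n → Char2 ι) :
    ∏ c : Fin (n + 1) → ZMod 2, φ (m + ∑ j, c j • Matrix.vecCons x v j) =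
      (∏ c : Fin n → ZMod 2, φ (m + ∑ j, c j • v j)) *
        ∏ c : Fin n → ZMod 2, φ (m + x + ∑ j, c j • v j) := by
  rw [← Equiv.prod_comp (Fin.consEquiv fun _ => ZMod 2), Fintype.prod_prod_type]
  refine (Fin.prod_univ_two _).trans ?_
  simp only [Fin.sum_univ_succ]
  congr 1 <;> refine Finset.prod_congr rfl fun c _ => ?_
  · change φ (m + ((0 : ZMod 2) • x + ∑ j, c j • v j)) = _
    rw [zero_smul, zero_add]
  · change φ (m + ((1 : ZMod 2) • x + ∑ j, c j • v j)) = _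
    rw [one_smul, add_assoc]

end AffineSubspaces

/-- Igusa's identity for the modular forms `S_{i,s}^g`. -/
theorem igusa_identity_4 (g : ℕ) (hg : 3 ≤ g)
    (τ : Matrix (Fin g) (Fin g) ℂ) (hτ : τ ∈ Siegel (Fin g)) :
    ((2 : ℂ) ^ (2 * g - 2) - 1) * Sform (Fin g) 1 8 τ =
      18 * Sform (Fin g) 2 4 τ + 168 * Sform (Fin g) 3 2 τ := by
  have hsq (m : Char2 (Fin g)) : thetaConst m τ ^ 2 = quadTheta (secondOrderTheta τ) m :=
    thetaConst_sq hτ m.1 m.2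
  let f (h m : Char2 (Fin g)) : ℂ := thetaConst m τ ^ 2 * thetaConst (m + h) τ ^ 2
  have hf (h m : Char2 (Fin g)) : f h (m + h) = f h m := by
    simp only [f]
    rw [add_assoc, ZModModule.add_self, add_zero, mul_comm]
  have h1 : 2 * Sform (Fin g) 1 8 τ = ∑ h ∈ {0}ᶜ, ∑ m, f h m ^ 4 := by
    have := Sform_mul_card_frames 1 8 τ
    rw [sum_linearIndependent_one,
      show 2 ^ 1 * ∏ j : Fin 1, (2 ^ 1 - 2 ^ j.val) = 2 from rfl, Nat.cast_ofNat] at this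
    rw [this]
    refine Finset.sum_congr rfl fun h _ => Finset.sum_congr rfl fun m _ => ?_
    simp only [prod_affine_vecCons fun w => thetaConst w τ]
    simp only [Finset.univ_unique, Finset.prod_singleton, Finset.univ_eq_empty, Finset.sum_empty,
      add_zero, f]
    ring
  have h2 : 24 * Sform (Fin g) 2 4 τ =
      ∑ h ∈ {0}ᶜ, ∑ k ∈ {0, h}ᶜ, ∑ m, f h m ^ 2 * f h (m + k) ^ 2 := by
    have := Sform_mul_card_frames 2 4 τ
    rw [sum_linearIndependent_two,
      show 2 ^ 2 * ∏ j : Fin 2, (2 ^ 2 - 2 ^ j.val) = 24 from rfl, Nat.cast_ofNat] at this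
    rw [this]
    refine Finset.sum_congr rfl fun h _ => Finset.sum_congr rfl fun k _ =>
      Finset.sum_congr rfl fun m _ => ?_
    simp only [prod_affine_vecCons fun w => thetaConst w τ]
    simp only [Finset.univ_unique, Finset.prod_singleton, Finset.univ_eq_empty, Finset.sum_empty,
      add_zero, f]
    ring
  have h3 : 1344 * Sform (Fin g) 3 2 τ = ∑ h ∈ {0}ᶜ, ∑ k ∈ {0, h}ᶜ, ∑ l ∈ {0, h, k, k + h}ᶜ,
      ∑ m, f h m * f h (m + k) * f h (m + l) * f h (m + k + l) := by
    have := Sform_mul_card_frames 3 2 τ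
    rw [sum_linearIndependent_three,
      show 2 ^ 3 * ∏ j : Fin 3, (2 ^ 3 - 2 ^ j.val) = 1344 from rfl, Nat.cast_ofNat] at this
    rw [this]
    refine Finset.sum_congr rfl fun h _ => Finset.sum_congr rfl fun k _ =>
      Finset.sum_congr rfl fun l _ => Finset.sum_congr rfl fun m _ => ?_
    simp only [prod_affine_vecCons fun w => thetaConst w τ]
    simp only [Finset.univ_unique, Finset.prod_singleton, Finset.univ_eq_empty, Finset.sum_empty,
      add_zero, f, add_right_comm m l k]
    ring
  have hrel (h : Char2 (Fin g)) (hh : h ∈ ({0}ᶜ : Finset (Char2 (Fin g)))) :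
      (2 ^ g) ^ 2 * ∑ m, f h m ^ 4 = ∑ k ∈ {0, h}ᶜ, ∑ l ∈ {0, h, k, k + h}ᶜ,
        ∑ m, f h m * f h (m + k) * f h (m + l) * f h (m + k + l) +
        6 * ∑ k ∈ {0, h}ᶜ, ∑ m, f h m ^ 2 * f h (m + k) ^ 2 + 4 * ∑ m, f h m ^ 4 := by
    rw [← sum_parallelepiped_eq_add (by simpa using hh) (hf h),
      sum_parallelepiped_eq (secondOrderTheta τ) h fun m => by simp only [f, hsq],
      Fintype.card_fin]
  have hsum := Finset.sum_congr rfl hrel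
  rw [← Finset.mul_sum, Finset.sum_add_distrib, Finset.sum_add_distrib, ← Finset.mul_sum,
    ← Finset.mul_sum, ← h1, ← h2, ← h3] at hsum
  have hpow : ((2 : ℂ) ^ g) ^ 2 = 4 * 2 ^ (2 * g - 2) := by
    rw [← pow_mul, show g * 2 = (2 * g - 2) + 2 by omega, pow_add]
    ring
  rw [hpow] at hsum
  linear_combination hsum / 8
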